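/- arXiv:1707.00839 — 6 statements merged into one kernel-verified Lean document; each statement's English description precedes it below -/
import Mathlib

section
/- Let n ∈ ℕ and a_0,…,a_n, b_0,…,b_n ∈ ℝ. Set P(X) = ∑_{k=0}^n b_k X^k and Q(X) = ∑_{k=0}^n a_k X^k, and define the operators L = φ*P(D) + Q(D) and L₁ = φ*P(D) − Q(−D), i.e. (L₁u)(t) = ∑_{k=0}^n b_k u^{(k)}(−t) − ∑_{k=0}^n (−1)^k a_k u^{(k)}(t). Then for every smooth function u : ℝ → ℝ and every t ∈ ℝ one has L₁(Lu)(t) = L(L₁u)(t), and both are equal to (S(D)u)(t), where S(X) := P(−X)P(X) − Q(−X)Q(X) ∈ ℝ[X]. -/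
open Polynomial Finset

/-- The real vector space of smooth functions `ℝ → ℝ`. -/
def smoothFunctions : Submodule ℝ (ℝ → ℝ) where
  carrier := {u | ContDiff ℝ (⊤ : ℕ∞) u}
  add_mem' hu hv := Set.mem_ofPred.2 ((Set.mem_ofPred.1 hu).add (Set.mem_ofPred.1 hv))
  zero_mem' := Set.mem_ofPred.2 contDiff_const
  smul_mem' c _ hu := Set.mem_ofPred.2 ((Set.mem_ofPred.1 hu).const_smul c)

namespace smoothFunctions

theorem contDiff_coe (u : smoothFunctions) : ContDiff ℝ (⊤ : ℕ∞) (u : ℝ → ℝ) := u.2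

theorem differentiable_coe (u : smoothFunctions) : Differentiable ℝ (u : ℝ → ℝ) :=
  (contDiff_coe u).differentiable (by simp)

/-- Differentiation on smooth functions. -/
noncomputable def D : Module.End ℝ smoothFunctions where
  toFun u := ⟨deriv u, (contDiff_infty_iff_deriv.1 (contDiff_coe u)).2⟩
  map_add' u v := by
    ext t
    exact deriv_add (differentiable_coe u t) (differentiable_coe v t)
  map_smul' c u := by
    ext t
    exact deriv_const_smul c (differentiable_coe u t)

/-- The reflection `u ↦ u(-·)` on smooth functions. -/
def reflection : Module.End ℝ smoothFunctions where
  toFun u := ⟨fun t => (u : ℝ → ℝ) (-t), (contDiff_coe u).comp contDiff_neg⟩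
  map_add' _ _ := rfl
  map_smul' _ _ := rfl

theorem reflection_apply (u : smoothFunctions) (t : ℝ) :
    (reflection u : ℝ → ℝ) t = (u : ℝ → ℝ) (-t) := rfl

theorem reflection_mul_reflection : reflection * reflection = 1 := by
  ext u t
  simp [reflection_apply]

theorem D_mul_reflection : D * reflection = reflection * -D := by
  ext u t
  exact deriv_comp_neg (u : ℝ → ℝ) t

theorem coe_D_pow (k : ℕ) (u : smoothFunctions) :
    ((D ^ k) u : ℝ → ℝ) = iteratedDeriv k u := by
  induction k with
  | zero => simp
  | succ k ih =>
    rw [pow_succ', iteratedDeriv_succ, ← ih]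
    rfl

theorem aeval_D_apply (R : ℝ[X]) (u : smoothFunctions) (t : ℝ) :
    (aeval D R u : ℝ → ℝ) t =
      ∑ k ∈ range (R.natDegree + 1), R.coeff k * iteratedDeriv k u t := by
  simp [aeval_eq_sum_range, LinearMap.sum_apply, Finset.sum_apply, coe_D_pow]

theorem aeval_D_sum_apply (s : Finset ℕ) (c : ℕ → ℝ) (u : smoothFunctions) (t : ℝ) :
    (aeval D (∑ k ∈ s, C (c k) * X ^ k) u : ℝ → ℝ) t =
      ∑ k ∈ s, c k * iteratedDeriv k u t := by
  simp [LinearMap.sum_apply, Finset.sum_apply, coe_D_pow, Module.algebraMap_end_apply]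

theorem aeval_D_sum_comp_neg_apply (s : Finset ℕ) (c : ℕ → ℝ) (u : smoothFunctions) (t : ℝ) :
    (aeval D ((∑ k ∈ s, C (c k) * X ^ k).comp (-X)) u : ℝ → ℝ) t =
      ∑ k ∈ s, (-1) ^ k * c k * iteratedDeriv k u t := by
  have h : (∑ k ∈ s, C (c k) * X ^ k).comp (-X) = ∑ k ∈ s, C ((-1) ^ k * c k) * X ^ k := by
    rw [Polynomial.sum_comp]
    refine Finset.sum_congr rfl fun k _ => ?_
    simp only [mul_comp, C_comp, pow_comp, X_comp, C_mul, C_pow, C_neg, C_1]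
    rw [neg_pow]
    ring
  rw [h, aeval_D_sum_apply]

theorem aeval_D_mul_reflection (R : ℝ[X]) :
    aeval D R * reflection = reflection * aeval D (R.comp (-X)) := by
  induction R using Polynomial.induction_on' with
  | add p q hp hq => simp only [map_add, add_mul, add_comp, mul_add, hp, hq]
  | monomial k c =>
    have h : SemiconjBy reflection (-D) D := D_mul_reflection.symm
    simpa [aeval_monomial, mul_assoc, (h.pow_right k).eq] using
      (Algebra.left_comm reflection c ((-D) ^ k)).symm

/-- The operator `φ*P(D) + Q(D)`. -/
noncomputable def reflectionOperator (P Q : ℝ[X]) : Module.End ℝ smoothFunctions :=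
  reflection * aeval D P + aeval D Q

theorem reflectionOperator_mul (P Q P' Q' : ℝ[X]) :
    reflectionOperator P Q * reflectionOperator P' Q' =
      reflectionOperator (P * Q' + Q.comp (-X) * P') (P.comp (-X) * P' + Q * Q') := by
  have h₁ : reflection * aeval D P * (reflection * aeval D P') =
      aeval D (P.comp (-X)) * aeval D P' := by
    rw [mul_assoc, ← mul_assoc (aeval D P), aeval_D_mul_reflection, ← mul_assoc, ← mul_assoc,
      reflection_mul_reflection, one_mul]
  have h₂ : aeval D Q * (reflection * aeval D P') =
      reflection * (aeval D (Q.comp (-X)) * aeval D P') := by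
    rw [← mul_assoc, aeval_D_mul_reflection, mul_assoc]
  simp only [reflectionOperator, add_mul, mul_add, h₁, h₂, map_add, map_mul, mul_assoc]
  abel

theorem reflectionOperator_zero_left (Q : ℝ[X]) : reflectionOperator 0 Q = aeval D Q := by
  simp [reflectionOperator]

theorem reflectionOperator_apply (P Q : ℝ[X]) (u : smoothFunctions) (t : ℝ) :
    (reflectionOperator P Q u : ℝ → ℝ) t =
      (aeval D P u : ℝ → ℝ) (-t) + (aeval D Q u : ℝ → ℝ) t := rfl

end smoothFunctions

/-- For `P(X) = ∑ b_k X^k`, `Q(X) = ∑ a_k X^k`, the operators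
`L = φ*P(D) + Q(D)` and `L₁ = φ*P(D) − Q(−D)` commute and
`L₁ L = L L₁ = S(D)` where `S(X) = P(−X)P(X) − Q(−X)Q(X)`. -/
theorem stmt_0 (n : ℕ) (a b : ℕ → ℝ)
    (P Q : Polynomial ℝ)
    (hP : P = ∑ k ∈ Finset.range (n + 1), Polynomial.C (b k) * Polynomial.X ^ k)
    (hQ : Q = ∑ k ∈ Finset.range (n + 1), Polynomial.C (a k) * Polynomial.X ^ k)
    (L L₁ : (ℝ → ℝ) → (ℝ → ℝ))
    (hL : ∀ (u : ℝ → ℝ) (t : ℝ), L u t =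
      (∑ k ∈ Finset.range (n + 1), a k * iteratedDeriv k u t)
        + ∑ k ∈ Finset.range (n + 1), b k * iteratedDeriv k u (-t))
    (hL₁ : ∀ (u : ℝ → ℝ) (t : ℝ), L₁ u t =
      (∑ k ∈ Finset.range (n + 1), b k * iteratedDeriv k u (-t))
        - ∑ k ∈ Finset.range (n + 1), (-1 : ℝ) ^ k * a k * iteratedDeriv k u t)
    (S : Polynomial ℝ)
    (hS : S = P.comp (-Polynomial.X) * P - Q.comp (-Polynomial.X) * Q)
    (u : ℝ → ℝ) (hu : ContDiff ℝ (⊤ : ℕ∞) u) (t : ℝ) :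
    L₁ (L u) t = L (L₁ u) t ∧
    L₁ (L u) t = ∑ k ∈ Finset.range (S.natDegree + 1), S.coeff k * iteratedDeriv k u t := by
  lift u to smoothFunctions using hu
  have hL' (v : smoothFunctions) : L v = smoothFunctions.reflectionOperator P Q v := by
    ext s
    rw [hL, smoothFunctions.reflectionOperator_apply, hP, hQ, smoothFunctions.aeval_D_sum_apply,
      smoothFunctions.aeval_D_sum_apply, add_comm]
  have hL₁' (v : smoothFunctions) :
      L₁ v = smoothFunctions.reflectionOperator P (-Q.comp (-X)) v := by
    ext s
    rw [hL₁, smoothFunctions.reflectionOperator_apply, map_neg, hP, hQ,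
      smoothFunctions.aeval_D_sum_apply, LinearMap.neg_apply, Submodule.coe_neg, Pi.neg_apply,
      smoothFunctions.aeval_D_sum_comp_neg_apply, sub_eq_add_neg]
  have hneg : (Q.comp (-X)).comp (-X) = Q := by simp [comp_assoc]
  have h₁ : smoothFunctions.reflectionOperator P (-Q.comp (-X)) *
      smoothFunctions.reflectionOperator P Q = aeval smoothFunctions.D S := by
    rw [smoothFunctions.reflectionOperator_mul, ← smoothFunctions.reflectionOperator_zero_left, hS,
      neg_comp, hneg]
    congr 1 <;> ring
  have h₂ : smoothFunctions.reflectionOperator P Q *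
      smoothFunctions.reflectionOperator P (-Q.comp (-X)) = aeval smoothFunctions.D S := by
    rw [smoothFunctions.reflectionOperator_mul, ← smoothFunctions.reflectionOperator_zero_left, hS]
    congr 1 <;> ring
  rw [hL', hL₁', hL₁', hL', ← Module.End.mul_apply, ← Module.End.mul_apply, h₁, h₂]
  exact ⟨rfl, smoothFunctions.aeval_D_apply S u t⟩
end

section
/- Let n ∈ ℕ and M, N ∈ M_n(ℂ) with M invertible and M·N = N·M. Then there exists a polynomial p ∈ ℂ[X] such that p(M)·N = N·p(M) and p(M)² = M, where p(M) denotes the evaluation of p at the matrix M. -/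
open Polynomial Matrix

namespace Polynomial

theorem Splits.dvd_pow_natDegree_of_roots {K : Type*} [Field K] {m f : K[X]} (hm : m.Monic)
    (hs : m.Splits) (hf : ∀ a ∈ m.roots, f.IsRoot a) : m ∣ f ^ m.natDegree := by
  have hprod : (m.roots.map (X - C ·)).prod ∣ (m.roots.map fun _ ↦ f).prod :=
    Multiset.prod_dvd_prod_of_dvd _ _ fun a ha ↦ dvd_iff_isRoot.mpr (hf a ha)
  rwa [← hs.eq_prod_roots_of_monic hm, Multiset.map_const', Multiset.prod_replicate,
    ← hs.natDegree_eq_card_roots] at hprod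

/-- Over an algebraically closed field, some polynomial agrees with a square root at each root
of `m`. -/
theorem exists_dvd_sq_sub_X_pow {K : Type*} [Field K] [IsAlgClosed K] {m : K[X]}
    (hm : m.Monic) : ∃ r : K[X], m ∣ (r ^ 2 - X) ^ m.natDegree := by
  classical
  choose s hs using fun a : K ↦ IsAlgClosed.exists_pow_nat_eq a two_pos
  refine ⟨Lagrange.interpolate m.roots.toFinset id s,
    (IsAlgClosed.splits m).dvd_pow_natDegree_of_roots hm fun a ha ↦ ?_⟩
  have hr := Lagrange.eval_interpolate_at_node (v := id) s (Set.injOn_id _)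
    (Multiset.mem_toFinset.mpr ha)
  rw [IsRoot, eval_sub, eval_pow, eval_X, sub_eq_zero]
  exact (congrArg (· ^ 2) hr).trans (hs a)

/-- The class of `X` is a square modulo a monic polynomial not vanishing at zero, over an
algebraically closed field of characteristic different from two. -/
theorem exists_dvd_sq_sub_X {K : Type*} [Field K] [IsAlgClosed K] [NeZero (2 : K)] {m : K[X]}
    (hm : m.Monic) (h0 : m.coeff 0 ≠ 0) : ∃ p : K[X], m ∣ p ^ 2 - X := by
  obtain ⟨r, hr⟩ := exists_dvd_sq_sub_X_pow hm
  let x := AdjoinRoot.root m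
  let y := AdjoinRoot.mk m r
  have hnil : IsNilpotent (y ^ 2 - x) := ⟨m.natDegree, by
    simpa [x, y] using AdjoinRoot.mk_eq_zero.mpr hr⟩
  have hx : IsUnit x := by
    obtain ⟨a, b, hab⟩ := irreducible_X.coprime_iff_not_dvd.mpr (mt X_dvd_iff.mp h0)
    refine .of_mul_eq_one (AdjoinRoot.mk m a) ?_
    simpa [x, mul_comm] using congrArg (AdjoinRoot.mk m) hab
  have hy : IsUnit y := by
    have := hnil.isUnit_add_left_of_commute hx (Commute.all _ _)
    rwa [add_sub_cancel, isUnit_pow_iff two_ne_zero] at this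
  have h2 : IsUnit (2 : AdjoinRoot m) := by
    simpa only [map_ofNat] using (IsUnit.mk0 (2 : K) two_ne_zero).map (AdjoinRoot.of m)
  obtain ⟨z, ⟨-, hz⟩, -⟩ := existsUnique_nilpotent_sub_and_aeval_eq_zero
    (P := X ^ 2 - C x) (x := y) (by simpa using hnil)
    (by simpa [one_add_one_eq_two] using h2.mul hy)
  obtain ⟨p, rfl⟩ := AdjoinRoot.mk_surjective z
  exact ⟨p, AdjoinRoot.mk_eq_zero.mp (by simpa [x] using hz)⟩

end Polynomial

/-- If `M ∈ M_n(ℂ)` is invertible and commutes with `N`, then there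
is a polynomial `p ∈ ℂ[X]` such that `p(M)` commutes with `N` and `p(M)² = M`. -/
theorem stmt_5 (n : ℕ) (M N : Matrix (Fin n) (Fin n) ℂ)
    (hM : IsUnit M) (hMN : M * N = N * M) :
    ∃ p : Polynomial ℂ,
      (Polynomial.aeval M) p * N = N * (Polynomial.aeval M) p ∧
      ((Polynomial.aeval M) p) ^ 2 = M := by
  have h0 : M.charpoly.coeff 0 ≠ 0 := by
    intro h
    have hdet := (M.isUnit_iff_isUnit_det.mp hM).ne_zero
    exact hdet (by rw [det_eq_sign_charpoly_coeff, h, mul_zero])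
  obtain ⟨p, q, hp⟩ := exists_dvd_sq_sub_X M.charpoly_monic h0
  have hsq := congrArg (aeval M) hp
  rw [map_mul, aeval_self_charpoly, zero_mul, map_sub, map_pow, aeval_X, sub_eq_zero] at hsq
  refine ⟨p, ?_, hsq⟩
  have hMN' : Commute N M := hMN.symm
  exact (Algebra.commute_of_mem_adjoin_singleton_of_commute
    (aeval_mem_adjoin_singleton ℂ M) hMN').symm
end

section
/- Let n ∈ ℕ and A, B, F, G ∈ M_n(ℝ) with F+G and F−G invertible. If u, v : ℝ → ℝ^n are differentiable functions satisfying F u'(t) + G u'(−t) + A u(t) + B u(−t) = 0 and F v'(t) + G v'(−t) + A v(t) + B v(−t) = 0 for all t ∈ ℝ, and u(0) = v(0), then u(t) = v(t) for all t ∈ ℝ. -/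
open Matrix

/-- The linear field governing twice the even and odd parts of a solution of the system with
reflection. -/
noncomputable def evenOddField {n : ℕ} (A B F G : Matrix (Fin n) (Fin n) ℝ) :
    ((Fin n → ℝ) × (Fin n → ℝ)) →ₗ[ℝ] ((Fin n → ℝ) × (Fin n → ℝ)) :=
  (((-((F - G)⁻¹ * (A - B))).mulVecLin).comp (LinearMap.snd ℝ _ _)).prod
    (((-((F + G)⁻¹ * (A + B))).mulVecLin).comp (LinearMap.fst ℝ _ _))

lemma eq_neg_inv_mul_mulVec {n : ℕ} {M N : Matrix (Fin n) (Fin n) ℝ} (hM : IsUnit M)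
    {x y : Fin n → ℝ} (h : M *ᵥ x + N *ᵥ y = 0) : x = (-(M⁻¹ * N)) *ᵥ y := by
  have hdet : IsUnit M.det := (Matrix.isUnit_iff_isUnit_det M).1 hM
  rw [Matrix.neg_mulVec, ← Matrix.mulVec_mulVec, ← Matrix.mulVec_neg,
    ← eq_neg_of_add_eq_zero_left h, Matrix.mulVec_mulVec, Matrix.nonsing_inv_mul _ hdet,
    Matrix.one_mulVec]

lemma hasDerivAt_evenOdd {n : ℕ} {A B F G : Matrix (Fin n) (Fin n) ℝ}
    (h1 : IsUnit (F + G)) (h2 : IsUnit (F - G)) {u : ℝ → Fin n → ℝ} (hu : Differentiable ℝ u)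
    (hue : ∀ t : ℝ, F.mulVec (deriv u t) + G.mulVec (deriv u (-t))
      + A.mulVec (u t) + B.mulVec (u (-t)) = 0) (t : ℝ) :
    HasDerivAt (fun s ↦ (u s + u (-s), u s - u (-s)))
      (evenOddField A B F G (u t + u (-t), u t - u (-t))) t := by
  have hr : HasDerivAt (fun s ↦ u (-s)) (-deriv u (-t)) t := by
    simpa [Function.comp_def] using (hu (-t)).hasDerivAt.scomp t (hasDerivAt_neg t)
  have ht := (hu t).hasDerivAt
  have e1 := hue t
  have e2 := hue (-t)
  rw [neg_neg] at e2
  have hp : deriv u t + -deriv u (-t) = (-((F - G)⁻¹ * (A - B))) *ᵥ (u t - u (-t)) := by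
    apply eq_neg_inv_mul_mulVec h2
    simp only [Matrix.sub_mulVec, Matrix.mulVec_add, Matrix.mulVec_sub, Matrix.mulVec_neg]
    linear_combination e1 - e2
  have hq : deriv u t - -deriv u (-t) = (-((F + G)⁻¹ * (A + B))) *ᵥ (u t + u (-t)) := by
    apply eq_neg_inv_mul_mulVec h1
    simp only [Matrix.add_mulVec, Matrix.mulVec_add, Matrix.mulVec_sub, Matrix.mulVec_neg]
    linear_combination e1 + e2
  have h := (ht.add hr).prodMk (ht.sub hr)
  rw [hp, hq] at h
  exact h

/-- Uniqueness for the homogeneous linear system with reflection: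
if `F+G` and `F−G` are invertible, two differentiable solutions of
`F u'(t) + G u'(−t) + A u(t) + B u(−t) = 0` with the same value at `0` coincide. -/
theorem stmt_9 (n : ℕ) (A B F G : Matrix (Fin n) (Fin n) ℝ)
    (h1 : IsUnit (F + G)) (h2 : IsUnit (F - G))
    (u v : ℝ → Fin n → ℝ)
    (hu : Differentiable ℝ u) (hv : Differentiable ℝ v)
    (hue : ∀ t : ℝ, F.mulVec (deriv u t) + G.mulVec (deriv u (-t))
      + A.mulVec (u t) + B.mulVec (u (-t)) = 0)
    (hve : ∀ t : ℝ, F.mulVec (deriv v t) + G.mulVec (deriv v (-t))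
      + A.mulVec (v t) + B.mulVec (v (-t)) = 0)
    (h0 : u 0 = v 0) :
    ∀ t : ℝ, u t = v t := by
  intro t
  have key := ODE_solution_unique_univ (v := fun _ ↦ evenOddField A B F G)
    (s := fun _ ↦ Set.univ) (t₀ := 0)
    (fun _ ↦ (evenOddField A B F G).toContinuousLinearMap.lipschitz.lipschitzOnWith)
    (fun s ↦ ⟨hasDerivAt_evenOdd h1 h2 hu hue s, trivial⟩)
    (fun s ↦ ⟨hasDerivAt_evenOdd h1 h2 hv hve s, trivial⟩) (by simp [h0])
  obtain ⟨hp, hq⟩ := Prod.mk.inj (congrFun key t)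
  ext i
  have hpi := congrFun hp i
  have hqi := congrFun hq i
  simp only [Pi.add_apply, Pi.sub_apply] at hpi hqi
  linarith
end

section
/- Let n ∈ ℕ and A, B, F, G ∈ M_n(ℝ) with F+G and F−G invertible. Let X, Y : ℝ → M_n(ℝ) be differentiable matrix-valued functions satisfying F X'(t) + G X'(−t) + A X(t) + B X(−t) = 0 and F Y'(t) + G Y'(−t) + A Y(t) + B Y(−t) = 0 for all t ∈ ℝ, with X(0) and Y(0) invertible. Then Y(t) = X(t)·X(0)⁻¹·Y(0) for all t ∈ ℝ; moreover, every differentiable u : ℝ → ℝ^n satisfying F u'(t) + G u'(−t) + A u(t) + B u(−t) = 0 for all t ∈ ℝ satisfies u(t) = X(t)·X(0)⁻¹·u(0) for all t ∈ ℝ. -/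
open Matrix

/-- A differentiable solution of the homogeneous system with reflection that vanishes at the
origin vanishes identically: its even and odd parts solve a linear first-order system. -/
theorem reflection_solution_eq_zero {n : ℕ} {A B F G : Matrix (Fin n) (Fin n) ℝ}
    (h1 : IsUnit (F + G)) (h2 : IsUnit (F - G)) {u u' : ℝ → Fin n → ℝ}
    (hu : ∀ t, HasDerivAt u (u' t) t)
    (heq : ∀ t, F *ᵥ u' t + G *ᵥ u' (-t) + A *ᵥ u t + B *ᵥ u (-t) = 0)
    (h0 : u 0 = 0) (t : ℝ) : u t = 0 := by
  have hneg (s : ℝ) : HasDerivAt (fun r => u (-r)) (-u' (-s)) s := by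
    have h := (hu (-s)).scomp s (hasDerivAt_neg s)
    rw [neg_one_smul] at h
    exact h
  let L : (Fin n → ℝ) × (Fin n → ℝ) →L[ℝ] (Fin n → ℝ) × (Fin n → ℝ) :=
    LinearMap.toContinuousLinearMap
      (((-((F - G)⁻¹ * (A - B))).mulVecLin ∘ₗ LinearMap.snd ℝ _ _).prod
        ((-((F + G)⁻¹ * (A + B))).mulVecLin ∘ₗ LinearMap.fst ℝ _ _))
  have hL (p : (Fin n → ℝ) × (Fin n → ℝ)) :
      L p = (-((F - G)⁻¹ * (A - B)) *ᵥ p.2, -((F + G)⁻¹ * (A + B)) *ᵥ p.1) := rfl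
  have hsolve {M N : Matrix (Fin n) (Fin n) ℝ} (hM : IsUnit M) {x y : Fin n → ℝ}
      (h : M *ᵥ x + N *ᵥ y = 0) : x = -(M⁻¹ * N) *ᵥ y := by
    have h' := congrArg (M⁻¹ *ᵥ ·) h
    simp only [mulVec_add, mulVec_mulVec, mulVec_zero,
      nonsing_inv_mul _ ((isUnit_iff_isUnit_det M).mp hM), one_mulVec] at h'
    rw [neg_mulVec]
    exact eq_neg_of_add_eq_zero_left h'
  have hderiv (s : ℝ) : HasDerivAt (fun r => (u r + u (-r), u r - u (-r)))
      (L (u s + u (-s), u s - u (-s))) s := by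
    have hs := heq s
    have hs' := heq (-s)
    rw [neg_neg] at hs'
    have heven : u' s + -u' (-s) = -((F - G)⁻¹ * (A - B)) *ᵥ (u s - u (-s)) := by
      refine hsolve h2 ?_
      rw [← sub_zero (0 : Fin n → ℝ)]
      nth_rewrite 1 [← hs]
      rw [← hs']
      simp only [sub_mulVec, mulVec_add, mulVec_sub, mulVec_neg]
      abel
    have hodd : u' s - -u' (-s) = -((F + G)⁻¹ * (A + B)) *ᵥ (u s + u (-s)) := by
      refine hsolve h1 ?_
      rw [← add_zero (0 : Fin n → ℝ)]
      nth_rewrite 1 [← hs]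
      rw [← hs']
      simp only [add_mulVec, mulVec_add, mulVec_sub, mulVec_neg]
      abel
    rw [hL, ← heven, ← hodd]
    exact ((hu s).add (hneg s)).prodMk ((hu s).sub (hneg s))
  have hzero (s : ℝ) :
      HasDerivAt (fun _ : ℝ => (0 : (Fin n → ℝ) × (Fin n → ℝ))) (L 0) s := by
    simpa using hasDerivAt_const s (0 : (Fin n → ℝ) × (Fin n → ℝ))
  have huniq := ODE_solution_unique_univ (v := fun _ => L) (s := fun _ => Set.univ) (t₀ := 0)
    (fun _ => L.lipschitz.lipschitzOnWith) (fun s => ⟨hderiv s, Set.mem_univ _⟩)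
    (fun s => ⟨hzero s, Set.mem_univ _⟩) (by simp [h0])
  have ht := congrFun huniq t
  simp only [Prod.mk_eq_zero] at ht
  have hself : u t = -u t := by
    nth_rewrite 2 [sub_eq_zero.mp ht.2]
    exact eq_neg_of_add_eq_zero_left ht.1
  exact self_eq_neg.mp hself

/-- A matrix solution that is invertible at the origin determines every vector solution. -/
theorem reflection_solution_eq_mulVec {n : ℕ} {A B F G : Matrix (Fin n) (Fin n) ℝ}
    (h1 : IsUnit (F + G)) (h2 : IsUnit (F - G)) {X X' : ℝ → Matrix (Fin n) (Fin n) ℝ}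
    (hXd : ∀ (t : ℝ) (i j : Fin n), HasDerivAt (fun s => X s i j) (X' t i j) t)
    (hXeq : ∀ t : ℝ, F * X' t + G * X' (-t) + A * X t + B * X (-t) = 0)
    (hX0 : IsUnit (X 0)) {u u' : ℝ → Fin n → ℝ} (hu : ∀ t, HasDerivAt u (u' t) t)
    (heq : ∀ t, F *ᵥ u' t + G *ᵥ u' (-t) + A *ᵥ u t + B *ᵥ u (-t) = 0) (t : ℝ) :
    u t = (X t * (X 0)⁻¹) *ᵥ u 0 := by
  set c := (X 0)⁻¹ *ᵥ u 0 with hc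
  have hXc (s : ℝ) : HasDerivAt (fun r => X r *ᵥ c) (X' s *ᵥ c) s :=
    hasDerivAt_pi.mpr fun i => by
      simp only [mulVec, dotProduct]
      exact HasDerivAt.fun_sum fun j _ => (hXd s i j).mul_const (c j)
  have hXceq (s : ℝ) : F *ᵥ (X' s *ᵥ c) + G *ᵥ (X' (-s) *ᵥ c) + A *ᵥ (X s *ᵥ c)
      + B *ᵥ (X (-s) *ᵥ c) = 0 := by
    simp only [mulVec_mulVec, ← add_mulVec, hXeq, zero_mulVec]
  have hdiff := reflection_solution_eq_zero (A := A) (B := B) h1 h2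
    (u := fun s => u s - X s *ᵥ c) (fun s => (hu s).sub (hXc s)) (fun s => by
      rw [← sub_zero (0 : Fin n → ℝ)]
      nth_rewrite 1 [← heq s]
      rw [← hXceq s]
      simp only [mulVec_sub]
      abel)
    (by simp [hc, mul_nonsing_inv _ ((isUnit_iff_isUnit_det _).mp hX0)]) t
  rw [← mulVec_mulVec]
  exact sub_eq_zero.mp hdiff

/-- If `F+G`, `F−G` are invertible, `X`, `Y` are differentiable
matrix solutions of the homogeneous system with reflection with `X(0)`, `Y(0)`
invertible, then `Y(t) = X(t)·X(0)⁻¹·Y(0)` for all `t`, and every differentiable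
vector solution `u` satisfies `u(t) = X(t)·X(0)⁻¹·u(0)`. -/
theorem stmt_10 (n : ℕ) (A B F G : Matrix (Fin n) (Fin n) ℝ)
    (h1 : IsUnit (F + G)) (h2 : IsUnit (F - G))
    (X Y X' Y' : ℝ → Matrix (Fin n) (Fin n) ℝ)
    (hXd : ∀ (t : ℝ) (i j : Fin n), HasDerivAt (fun s => X s i j) (X' t i j) t)
    (hYd : ∀ (t : ℝ) (i j : Fin n), HasDerivAt (fun s => Y s i j) (Y' t i j) t)
    (hXeq : ∀ t : ℝ, F * X' t + G * X' (-t) + A * X t + B * X (-t) = 0)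
    (hYeq : ∀ t : ℝ, F * Y' t + G * Y' (-t) + A * Y t + B * Y (-t) = 0)
    (hX0 : IsUnit (X 0)) (hY0 : IsUnit (Y 0)) :
    (∀ t : ℝ, Y t = X t * (X 0)⁻¹ * Y 0) ∧
    (∀ u : ℝ → Fin n → ℝ, Differentiable ℝ u →
      (∀ t : ℝ, F.mulVec (deriv u t) + G.mulVec (deriv u (-t))
        + A.mulVec (u t) + B.mulVec (u (-t)) = 0) →
      ∀ t : ℝ, u t = (X t * (X 0)⁻¹).mulVec (u 0)) := by
  refine ⟨fun t => ?_, fun u hu heq =>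
    reflection_solution_eq_mulVec h1 h2 hXd hXeq hX0 (fun t => (hu t).hasDerivAt) heq⟩
  ext i j
  have hcol := reflection_solution_eq_mulVec h1 h2 hXd hXeq hX0
    (u := fun s i => Y s i j) (u' := fun s i => Y' s i j)
    (fun s => hasDerivAt_pi.mpr fun i => hYd s i j)
    (fun s => funext fun i => congrFun (congrFun (hYeq s) i) j) t
  exact congrFun hcol i
end

section
/- Let n ∈ ℕ and A, B, F, G ∈ M_n(ℝ) with F+G and F−G invertible. Set E := (F−G)⁻¹(A−B)(F+G)⁻¹(A+B) and define, for t ∈ ℝ, S₁(t) := ∑_{k=0}^∞ (t^{2k}/(2k)!)·E^k and S₂(t) := ∑_{k=0}^∞ (t^{2k+1}/(2k+1)!)·E^k (both series converge absolutely for every t), and X(t) := S₁(t) − (F+G)⁻¹(A+B)·S₂(t). Then X(0) is the identity matrix, X is differentiable with X'(t) = E·S₂(t) − (F+G)⁻¹(A+B)·S₁(t) for every t ∈ ℝ, and F X'(t) + G X'(−t) + A X(t) + B X(−t) = 0 for all t ∈ ℝ. -/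
open Matrix

section EvenOddExponentialSeries

variable {𝔸 : Type*} [NormedRing 𝔸]

theorem norm_pow_le_norm_one_mul (a : 𝔸) (k : ℕ) : ‖a ^ k‖ ≤ ‖(1 : 𝔸)‖ * ‖a‖ ^ k := by
  induction k with
  | zero => simp
  | succ k ih =>
    calc ‖a ^ (k + 1)‖ ≤ ‖a ^ k‖ * ‖a‖ := by rw [pow_succ]; exact norm_mul_le _ _
      _ ≤ ‖(1 : 𝔸)‖ * ‖a‖ ^ k * ‖a‖ := by gcongr
      _ = ‖(1 : 𝔸)‖ * ‖a‖ ^ (k + 1) := by ring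

variable [NormedAlgebra ℝ 𝔸]

theorem summable_norm_even_series (a : 𝔸) (t : ℝ) :
    Summable fun k : ℕ => ‖(t ^ (2 * k) / (2 * k).factorial : ℝ) • a ^ k‖ := by
  have hs := ((Real.summable_pow_div_factorial (|t| * (1 + ‖a‖))).comp_injective
    (mul_right_injective₀ (two_ne_zero' ℕ))).mul_left ‖(1 : 𝔸)‖
  refine Summable.of_nonneg_of_le (fun _ => norm_nonneg _) (fun k => ?_) hs
  have hle : ‖a‖ ^ k ≤ (1 + ‖a‖) ^ (2 * k) :=
    (pow_le_pow_left₀ (norm_nonneg a) (by linarith) k).trans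
      (pow_le_pow_right₀ (by linarith [norm_nonneg a]) (by lia))
  rw [norm_smul, norm_div, norm_pow, Real.norm_eq_abs, RCLike.norm_natCast]
  calc |t| ^ (2 * k) / (2 * k).factorial * ‖a ^ k‖
      ≤ |t| ^ (2 * k) / (2 * k).factorial * (‖(1 : 𝔸)‖ * (1 + ‖a‖) ^ (2 * k)) := by
        gcongr
        exact (norm_pow_le_norm_one_mul a k).trans (by gcongr)
    _ = _ := by simp only [Function.comp_apply, mul_pow]; ring

theorem summable_norm_odd_series (a : 𝔸) (t : ℝ) :
    Summable fun k : ℕ => ‖(t ^ (2 * k + 1) / (2 * k + 1).factorial : ℝ) • a ^ k‖ := by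
  refine Summable.of_nonneg_of_le (fun _ => norm_nonneg _) (fun k => ?_)
    ((summable_norm_even_series a t).mul_left |t|)
  simp only [norm_smul, norm_div, norm_pow, Real.norm_eq_abs, RCLike.norm_natCast]
  rw [← mul_assoc, ← mul_div_assoc, ← pow_succ']
  gcongr
  lia

theorem hasDerivAt_pow_succ_div_factorial (m : ℕ) (s : ℝ) :
    HasDerivAt (fun s : ℝ => s ^ (m + 1) / (m + 1).factorial) (s ^ m / m.factorial) s := by
  have h := (hasDerivAt_pow (m + 1) s).div_const ((m + 1).factorial : ℝ)
  have hcoeff : ((m + 1 : ℕ) : ℝ) * s ^ (m + 1 - 1) / (m + 1).factorial =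
      s ^ m / m.factorial := by
    rw [Nat.factorial_succ, Nat.add_sub_cancel]
    push_cast
    field_simp
  rwa [hcoeff] at h

theorem norm_pow_div_factorial_smul_le (a : 𝔸) (m : ℕ) {s r : ℝ} (h : |s| ≤ |r|) :
    ‖(s ^ m / m.factorial : ℝ) • a‖ ≤ ‖(r ^ m / m.factorial : ℝ) • a‖ := by
  simp only [norm_smul, norm_div, norm_pow, Real.norm_eq_abs]
  have := pow_le_pow_left₀ (abs_nonneg s) h m
  gcongr

theorem abs_le_abs_of_mem_ball_zero {s r : ℝ} (h : s ∈ Metric.ball (0 : ℝ) r) : |s| ≤ |r| :=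
  (mem_ball_zero_iff.1 h).le.trans (le_abs_self r)

variable [CompleteSpace 𝔸]

theorem hasDerivAt_tsum_odd_series (a : 𝔸) (t : ℝ) :
    HasDerivAt (fun s : ℝ => ∑' k : ℕ, (s ^ (2 * k + 1) / (2 * k + 1).factorial : ℝ) • a ^ k)
      (∑' k : ℕ, (t ^ (2 * k) / (2 * k).factorial : ℝ) • a ^ k) t := by
  have ht : t ∈ Metric.ball (0 : ℝ) (|t| + 1) := by simp
  have h0 : (0 : ℝ) ∈ Metric.ball (0 : ℝ) (|t| + 1) := by simp; positivity
  have hderiv (k : ℕ) (s : ℝ) (_ : s ∈ Metric.ball (0 : ℝ) (|t| + 1)) :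
      HasDerivAt (fun s : ℝ => (s ^ (2 * k + 1) / (2 * k + 1).factorial : ℝ) • a ^ k)
        ((s ^ (2 * k) / (2 * k).factorial : ℝ) • a ^ k) s :=
    (hasDerivAt_pow_succ_div_factorial (2 * k) s).smul_const (a ^ k)
  have hbound (k : ℕ) (s : ℝ) (hs : s ∈ Metric.ball (0 : ℝ) (|t| + 1)) :
      ‖(s ^ (2 * k) / (2 * k).factorial : ℝ) • a ^ k‖ ≤
        ‖((|t| + 1) ^ (2 * k) / (2 * k).factorial : ℝ) • a ^ k‖ :=
    norm_pow_div_factorial_smul_le _ _ (abs_le_abs_of_mem_ball_zero hs)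
  exact hasDerivAt_tsum_of_isPreconnected (summable_norm_even_series a (|t| + 1))
    Metric.isOpen_ball (convex_ball _ _).isPreconnected hderiv hbound h0
    (summable_norm_odd_series a 0).of_norm ht

theorem hasDerivAt_tsum_even_series (a : 𝔸) (t : ℝ) :
    HasDerivAt (fun s : ℝ => ∑' k : ℕ, (s ^ (2 * k) / (2 * k).factorial : ℝ) • a ^ k)
      (a * ∑' k : ℕ, (t ^ (2 * k + 1) / (2 * k + 1).factorial : ℝ) • a ^ k) t := by
  have hsplit : (fun s : ℝ => ∑' k : ℕ, (s ^ (2 * k) / (2 * k).factorial : ℝ) • a ^ k) =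
      fun s => 1 + ∑' k : ℕ, (s ^ (2 * k + 1 + 1) / (2 * k + 1 + 1).factorial : ℝ) •
        a ^ (k + 1) := by
    funext s
    rw [(summable_norm_even_series a s).of_norm.tsum_eq_zero_add]
    simp [mul_add]
  have hshift : Summable fun k : ℕ =>
      ((0 : ℝ) ^ (2 * k + 1 + 1) / (2 * k + 1 + 1).factorial : ℝ) • a ^ (k + 1) :=
    (summable_nat_add_iff 1).2 (summable_norm_even_series a 0).of_norm
  have ht : t ∈ Metric.ball (0 : ℝ) (|t| + 1) := by simp
  have h0 : (0 : ℝ) ∈ Metric.ball (0 : ℝ) (|t| + 1) := by simp; positivity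
  have hderiv (k : ℕ) (s : ℝ) (_ : s ∈ Metric.ball (0 : ℝ) (|t| + 1)) :
      HasDerivAt
        (fun s : ℝ => (s ^ (2 * k + 1 + 1) / (2 * k + 1 + 1).factorial : ℝ) • a ^ (k + 1))
        (a * (s ^ (2 * k + 1) / (2 * k + 1).factorial : ℝ) • a ^ k) s := by
    rw [mul_smul_comm, ← pow_succ']
    exact (hasDerivAt_pow_succ_div_factorial (2 * k + 1) s).smul_const (a ^ (k + 1))
  have hbound (k : ℕ) (s : ℝ) (hs : s ∈ Metric.ball (0 : ℝ) (|t| + 1)) :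
      ‖a * (s ^ (2 * k + 1) / (2 * k + 1).factorial : ℝ) • a ^ k‖ ≤
        ‖a‖ * ‖((|t| + 1) ^ (2 * k + 1) / (2 * k + 1).factorial : ℝ) • a ^ k‖ :=
    (norm_mul_le _ _).trans (mul_le_mul_of_nonneg_left
      (norm_pow_div_factorial_smul_le _ _ (abs_le_abs_of_mem_ball_zero hs)) (norm_nonneg a))
  rw [hsplit, ← (summable_norm_odd_series a t).of_norm.tsum_mul_left]
  exact (hasDerivAt_tsum_of_isPreconnected
    ((summable_norm_odd_series a (|t| + 1)).mul_left ‖a‖) Metric.isOpen_ball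
    (convex_ball _ _).isPreconnected hderiv hbound h0 hshift ht).const_add 1

end EvenOddExponentialSeries

/-- With `E = (F−G)⁻¹(A−B)(F+G)⁻¹(A+B)`, the series
`S₁(t) = ∑ t^{2k}/(2k)!·E^k`, `S₂(t) = ∑ t^{2k+1}/(2k+1)!·E^k` converge (absolutely)
for every `t`, and `X(t) = S₁(t) − (F+G)⁻¹(A+B)S₂(t)` satisfies `X(0) = Id`, is
differentiable with `X'(t) = E·S₂(t) − (F+G)⁻¹(A+B)·S₁(t)`, and solves the
homogeneous system with reflection. -/
theorem stmt_11 (n : ℕ) (A B F G : Matrix (Fin n) (Fin n) ℝ)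
    (h1 : IsUnit (F + G)) (h2 : IsUnit (F - G))
    (E : Matrix (Fin n) (Fin n) ℝ)
    (hE : E = (F - G)⁻¹ * (A - B) * (F + G)⁻¹ * (A + B))
    (S₁ S₂ X X' : ℝ → Matrix (Fin n) (Fin n) ℝ)
    (hS₁ : ∀ t : ℝ, S₁ t = ∑' k : ℕ, (t ^ (2 * k) / (2 * k).factorial : ℝ) • E ^ k)
    (hS₂ : ∀ t : ℝ, S₂ t = ∑' k : ℕ, (t ^ (2 * k + 1) / (2 * k + 1).factorial : ℝ) • E ^ k)
    (hX : ∀ t : ℝ, X t = S₁ t - (F + G)⁻¹ * (A + B) * S₂ t)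
    (hX' : ∀ t : ℝ, X' t = E * S₂ t - (F + G)⁻¹ * (A + B) * S₁ t) :
    (∀ t : ℝ, Summable fun k : ℕ => (t ^ (2 * k) / (2 * k).factorial : ℝ) • E ^ k) ∧
    (∀ t : ℝ, Summable fun k : ℕ => (t ^ (2 * k + 1) / (2 * k + 1).factorial : ℝ) • E ^ k) ∧
    X 0 = 1 ∧
    (∀ (t : ℝ) (i j : Fin n), HasDerivAt (fun s => X s i j) (X' t i j) t) ∧
    (∀ t : ℝ, F * X' t + G * X' (-t) + A * X t + B * X (-t) = 0) := by
  let _ : NormedRing (Matrix (Fin n) (Fin n) ℝ) := Matrix.linftyOpNormedRing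
  let _ : NormedAlgebra ℝ (Matrix (Fin n) (Fin n) ℝ) := Matrix.linftyOpNormedAlgebra
  have hcancel₁ : (F + G) * (F + G)⁻¹ = 1 :=
    mul_nonsing_inv _ ((isUnit_iff_isUnit_det _).1 h1)
  have hcancel₂ : (F - G) * (F - G)⁻¹ = 1 :=
    mul_nonsing_inv _ ((isUnit_iff_isUnit_det _).1 h2)
  have hS₁_deriv (t : ℝ) : HasDerivAt S₁ (E * S₂ t) t := by
    rw [funext hS₁, hS₂]
    exact hasDerivAt_tsum_even_series E t
  have hS₂_deriv (t : ℝ) : HasDerivAt S₂ (S₁ t) t := by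
    rw [funext hS₂, hS₁]
    exact hasDerivAt_tsum_odd_series E t
  refine ⟨fun t => (summable_norm_even_series E t).of_norm,
    fun t => (summable_norm_odd_series E t).of_norm, ?_, fun t i j => ?_, fun t => ?_⟩
  · have hS₁_zero : S₁ 0 = 1 := by
      rw [hS₁, tsum_eq_single 0 (fun k hk => by simp [hk])]
      simp
    have hS₂_zero : S₂ 0 = 0 := by simp [hS₂]
    simp [hX, hS₁_zero, hS₂_zero]
  · have hX_deriv : HasDerivAt X (X' t) t := by
      rw [funext hX, hX']
      exact (hS₁_deriv t).sub ((hS₂_deriv t).const_mul _)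
    exact (LinearMap.toContinuousLinearMap
      (Matrix.entryLinearMap ℝ ℝ i j)).hasFDerivAt.comp_hasDerivAt t hX_deriv
  · have hS₁_even : S₁ (-t) = S₁ t := by simp [hS₁, pow_mul]
    have hS₂_odd : S₂ (-t) = -S₂ t := by
      simp [hS₂, pow_succ, pow_mul, neg_div, tsum_neg]
    have heven : (F + G) * ((F + G)⁻¹ * (A + B)) = A + B := by
      rw [← mul_assoc, hcancel₁, one_mul]
    have hodd : (F - G) * E = (A - B) * ((F + G)⁻¹ * (A + B)) := by
      rw [hE]
      simp only [← mul_assoc, hcancel₂, one_mul]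
    rw [hX', hX', hX, hX, hS₁_even, hS₂_odd]
    generalize (F + G)⁻¹ * (A + B) = P at heven hodd ⊢
    calc _ = ((F - G) * E - (A - B) * P) * S₂ t - ((F + G) * P - (A + B)) * S₁ t := by
          noncomm_ring
      _ = 0 := by simp [heven, hodd]
end

section
/- Let n ∈ ℕ, A, B, F, G ∈ M_n(ℝ) with F+G and F−G invertible, and let γ : ℝ → ℝ^n be continuous. Let X, Y : ℝ → M_n(ℝ) be differentiable with F X'(t) + G X'(−t) + A X(t) + B X(−t) = 0 and F Y'(t) − G Y'(−t) + A Y(t) − B Y(−t) = 0 for all t ∈ ℝ, and with X(0), Y(0) invertible. Suppose r ∈ (0,∞] is such that 𝒳(s) is invertible for every s ∈ (−r,r). For s ∈ (−r,r), let (w₁(s), w₂(s)) ∈ ℝ^n × ℝ^n be the block components of 𝒳(s)⁻¹ applied to the stacked vector ((F−G)⁻¹γ_o(s), (F+G)⁻¹γ_e(s)), where γ_e(s) := (γ(s)+γ(−s))/2 and γ_o(s) := (γ(s)−γ(−s))/2. Then: (i) for every c ∈ ℝ^n, the function u(t) := X(t)c + X(t)·∫₀ᵗ w₁(s) ds + Y(t)·∫₀ᵗ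 w₂(s) ds is differentiable on (−r,r) and satisfies F u'(t) + G u'(−t) + A u(t) + B u(−t) = γ(t) for all t ∈ (−r,r); (ii) every differentiable function v on (−r,r) satisfying F v'(t) + G v'(−t) + A v(t) + B v(−t) = γ(t) for all t ∈ (−r,r) coincides on (−r,r) with the function u obtained from (i) with c = X(0)⁻¹·v(0). -/
open Matrix intervalIntegral

/-- Even part of a matrix-valued function: `Z_e(t) = (Z(t) + Z(−t))/2`. -/
noncomputable def evenPartR {n : ℕ} (Z : ℝ → Matrix (Fin n) (Fin n) ℝ) (t : ℝ) :
    Matrix (Fin n) (Fin n) ℝ :=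
  (2 : ℝ)⁻¹ • (Z t + Z (-t))

/-- Odd part of a matrix-valued function: `Z_o(t) = (Z(t) − Z(−t))/2`. -/
noncomputable def oddPartR {n : ℕ} (Z : ℝ → Matrix (Fin n) (Fin n) ℝ) (t : ℝ) :
    Matrix (Fin n) (Fin n) ℝ :=
  (2 : ℝ)⁻¹ • (Z t - Z (-t))

/-- The block matrix `𝒳(t)` with block rows `(X_e(t), Y_o(t))` and `(X_o(t), Y_e(t))`. -/
noncomputable def scrX {n : ℕ} (X Y : ℝ → Matrix (Fin n) (Fin n) ℝ) (t : ℝ) :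
    Matrix (Fin n ⊕ Fin n) (Fin n ⊕ Fin n) ℝ :=
  Matrix.fromBlocks (evenPartR X t) (oddPartR Y t) (oddPartR X t) (evenPartR Y t)

/-- Product rule for a matrix, differentiable entrywise, applied to a vector. -/
theorem hasDerivAt_mulVec {n : ℕ} {X : ℝ → Matrix (Fin n) (Fin n) ℝ}
    {X' : Matrix (Fin n) (Fin n) ℝ} {w : ℝ → Fin n → ℝ} {w' : Fin n → ℝ} {t : ℝ}
    (hX : ∀ i j, HasDerivAt (fun s => X s i j) (X' i j) t) (hw : HasDerivAt w w' t) :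
    HasDerivAt (fun s => (X s).mulVec (w s)) (X'.mulVec (w t) + (X t).mulVec w') t := by
  rw [hasDerivAt_pi] at hw ⊢
  intro i
  have h := HasDerivAt.fun_sum (u := Finset.univ) fun j _ => (hX i j).mul (hw j)
  simpa [Matrix.mulVec, dotProduct, Finset.sum_add_distrib] using h

theorem continuous_of_entries_hasDerivAt {n : ℕ} {X X' : ℝ → Matrix (Fin n) (Fin n) ℝ}
    (hX : ∀ t i j, HasDerivAt (fun s => X s i j) (X' t i j) t) : Continuous X :=
  continuous_matrix fun i j => continuous_iff_continuousAt.2 fun t => (hX t i j).continuousAt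

theorem continuous_scrX {n : ℕ} {X Y : ℝ → Matrix (Fin n) (Fin n) ℝ}
    (hX : Continuous X) (hY : Continuous Y) : Continuous (scrX X Y) := by
  unfold scrX evenPartR oddPartR
  exact Continuous.matrix_fromBlocks (by fun_prop) (by fun_prop) (by fun_prop) (by fun_prop)

theorem continuousAt_matrix_inv_comp {m : Type*} [Fintype m] [DecidableEq m]
    {M : ℝ → Matrix m m ℝ} {s : ℝ} (hM : Continuous M) (hs : IsUnit (M s)) :
    ContinuousAt (fun t => (M t)⁻¹) s := by
  have hdet : (M s).det ≠ 0 := ((Matrix.isUnit_iff_isUnit_det _).1 hs).ne_zero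
  simp only [Matrix.inv_def, Ring.inverse_eq_inv']
  exact (hM.matrix_det.continuousAt.inv₀ hdet).smul hM.matrix_adjugate.continuousAt

theorem scrX_mulVec_eq_iff {n : ℕ} (X Y : ℝ → Matrix (Fin n) (Fin n) ℝ) (s : ℝ)
    (a b p q : Fin n → ℝ) :
    (scrX X Y s).mulVec (Sum.elim a b) = Sum.elim p q ↔
      (evenPartR X s).mulVec a + (oddPartR Y s).mulVec b = p ∧
        (oddPartR X s).mulVec a + (evenPartR Y s).mulVec b = q := by
  rw [scrX, Matrix.fromBlocks_mulVec, Sum.elim_eq_iff]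
  rfl

theorem evenPartR_neg {n : ℕ} (Z : ℝ → Matrix (Fin n) (Fin n) ℝ) (t : ℝ) :
    evenPartR Z (-t) = evenPartR Z t := by
  simp [evenPartR, add_comm]

theorem oddPartR_neg {n : ℕ} (Z : ℝ → Matrix (Fin n) (Fin n) ℝ) (t : ℝ) :
    oddPartR Z (-t) = -oddPartR Z t := by
  simp [oddPartR, ← smul_neg]

theorem evenPartR_add_oddPartR {n : ℕ} (Z : ℝ → Matrix (Fin n) (Fin n) ℝ) (t : ℝ) :
    evenPartR Z t + oddPartR Z t = Z t := by
  simp only [evenPartR, oddPartR]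
  module

theorem evenPartR_sub_oddPartR {n : ℕ} (Z : ℝ → Matrix (Fin n) (Fin n) ℝ) (t : ℝ) :
    evenPartR Z t - oddPartR Z t = Z (-t) := by
  simp only [evenPartR, oddPartR]
  module

/-- The block system `𝒳 (a, b) = (p, q)` at `s`, rewritten through the values of `X` and `Y` at
`s` and `-s`. -/
theorem mulVec_eq_of_scrX_mulVec_eq {n : ℕ} {X Y : ℝ → Matrix (Fin n) (Fin n) ℝ} {s : ℝ}
    {a b p q : Fin n → ℝ} (h : (scrX X Y s).mulVec (Sum.elim a b) = Sum.elim p q) :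
    (X s).mulVec a + (Y s).mulVec b = p + q ∧
      -(X (-s)).mulVec a + (Y (-s)).mulVec b = q - p := by
  obtain ⟨rfl, rfl⟩ := (scrX_mulVec_eq_iff ..).1 h
  rw [← evenPartR_add_oddPartR X s, ← evenPartR_add_oddPartR Y s,
    ← evenPartR_sub_oddPartR X s, ← evenPartR_sub_oddPartR Y s]
  simp only [Matrix.add_mulVec, Matrix.sub_mulVec]
  constructor <;> abel

/-- Reflecting the argument and the parities of the right-hand side reflects the solution. -/
theorem scrX_neg_mulVec_eq {n : ℕ} {X Y : ℝ → Matrix (Fin n) (Fin n) ℝ} {s : ℝ}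
    {a b p q : Fin n → ℝ} (h : (scrX X Y (-s)).mulVec (Sum.elim a b) = Sum.elim (-p) q) :
    (scrX X Y s).mulVec (Sum.elim (-a) b) = Sum.elim p q := by
  rw [scrX_mulVec_eq_iff] at h ⊢
  simp only [evenPartR_neg, oddPartR_neg, Matrix.neg_mulVec, Matrix.mulVec_neg] at h ⊢
  refine ⟨?_, h.2⟩
  rw [← neg_inj, ← h.1]
  abel

theorem hasDerivAt_integral_of_continuousOn {E : Type*} [NormedAddCommGroup E] [NormedSpace ℝ E]
    [CompleteSpace E] {J : Set ℝ} (hJo : IsOpen J) (hJc : J.OrdConnected) (h0 : (0 : ℝ) ∈ J)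
    {w : ℝ → E} (hw : ContinuousOn w J) {t : ℝ} (ht : t ∈ J) :
    HasDerivAt (fun x => ∫ s in (0 : ℝ)..x, w s) (w t) t :=
  integral_hasDerivAt_right ((hw.mono (hJc.uIcc_subset h0 ht)).intervalIntegrable)
    (hw.stronglyMeasurableAtFilter hJo t ht) (hw.continuousAt (hJo.mem_nhds ht))

theorem integral_neg_of_eqOn {E : Type*} [NormedAddCommGroup E] [NormedSpace ℝ E]
    {J : Set ℝ} (hJc : J.OrdConnected) (h0 : (0 : ℝ) ∈ J) {w z : ℝ → E}
    (h : ∀ s ∈ J, w (-s) = z s) {t : ℝ} (ht : t ∈ J) :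
    ∫ s in (0 : ℝ)..(-t), w s = -∫ s in (0 : ℝ)..t, z s := by
  rw [← integral_congr fun s hs => h s (hJc.uIcc_subset h0 ht hs), integral_comp_neg, neg_zero,
    integral_symm]

/-- Uniqueness for the homogeneous initial value problem with reflection. -/
theorem eq_zero_of_reflection_ode {n : ℕ} {A B F G : Matrix (Fin n) (Fin n) ℝ}
    (h1 : IsUnit (F + G)) (h2 : IsUnit (F - G)) {r : ℝ} (hr : 0 < r)
    {d d' : ℝ → Fin n → ℝ} (hd : ∀ t ∈ Set.Ioo (-r) r, HasDerivAt d (d' t) t)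
    (heq : ∀ t ∈ Set.Ioo (-r) r,
      F.mulVec (d' t) + G.mulVec (d' (-t)) + A.mulVec (d t) + B.mulVec (d (-t)) = 0)
    (hd0 : d 0 = 0) : ∀ t ∈ Set.Ioo (-r) r, d t = 0 := by
  have hneg : ∀ t ∈ Set.Ioo (-r) r, -t ∈ Set.Ioo (-r) r := fun t ht =>
    ⟨neg_lt_neg ht.2, neg_lt.1 ht.1⟩
  let P : (Fin n → ℝ) →L[ℝ] (Fin n → ℝ) :=
    (Matrix.mulVecLin (-((F - G)⁻¹ * (A - B)))).toContinuousLinearMap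
  let Q : (Fin n → ℝ) →L[ℝ] (Fin n → ℝ) :=
    (Matrix.mulVecLin (-((F + G)⁻¹ * (A + B)))).toContinuousLinearMap
  let L : (Fin n → ℝ) × (Fin n → ℝ) →L[ℝ] (Fin n → ℝ) × (Fin n → ℝ) :=
    (P.comp (ContinuousLinearMap.snd ℝ _ _)).prod (Q.comp (ContinuousLinearMap.fst ℝ _ _))
  have hsolve : ∀ {M N : Matrix (Fin n) (Fin n) ℝ} {x y : Fin n → ℝ}, IsUnit M →
      M.mulVec x + N.mulVec y = 0 → x = (-(M⁻¹ * N)).mulVec y := by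
    intro M N x y hM h
    rw [Matrix.neg_mulVec, ← Matrix.mulVec_mulVec, eq_neg_of_add_eq_zero_right h,
      Matrix.mulVec_neg, neg_neg, Matrix.mulVec_mulVec,
      Matrix.nonsing_inv_mul _ ((Matrix.isUnit_iff_isUnit_det _).1 hM), Matrix.one_mulVec]
  have hz : ∀ t ∈ Set.Ioo (-r) r,
      HasDerivAt (fun s => (d s + d (-s), d s - d (-s))) (L (d t + d (-t), d t - d (-t))) t := by
    intro t ht
    have hdn : HasDerivAt (fun s => d (-s)) (-d' (-t)) t := by
      simpa [Function.comp_def] using (hd (-t) (hneg t ht)).scomp t (hasDerivAt_neg t)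
    have e1 := heq t ht
    have e2 := heq (-t) (hneg t ht)
    rw [neg_neg] at e2
    refine (((hd t ht).add hdn).prodMk ((hd t ht).sub hdn)).congr_deriv ?_
    refine Prod.ext ?_ ?_
    · refine hsolve (y := d t - d (-t)) h2 ?_
      simp only [Matrix.sub_mulVec, Matrix.mulVec_add, Matrix.mulVec_sub, Matrix.mulVec_neg]
      rw [← sub_eq_zero.2 (e1.trans e2.symm)]
      abel
    · refine hsolve (y := d t + d (-t)) h1 ?_
      simp only [Matrix.add_mulVec, Matrix.mulVec_add, Matrix.mulVec_sub, Matrix.mulVec_neg]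
      rw [← (congrArg₂ (· + ·) e1 e2).trans (add_zero 0)]
      abel
  have huniq := ODE_solution_unique_of_mem_Ioo (v := fun _ => L) (s := fun _ => Set.univ)
    (g := fun _ => 0) (t₀ := 0) (fun _ _ => L.lipschitz.lipschitzOnWith)
    ⟨neg_lt_zero.2 hr, hr⟩ (fun t ht => ⟨hz t ht, trivial⟩)
    (fun t _ => ⟨by simpa using hasDerivAt_const t (0 : (Fin n → ℝ) × (Fin n → ℝ)), trivial⟩)
    (by simp [hd0])
  intro t ht
  have h := huniq ht
  simp only [Prod.mk_eq_zero] at h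
  have h2d : (2 : ℝ) • d t = 0 := by
    rw [← add_zero (0 : Fin n → ℝ)]
    nth_rewrite 1 [← h.1]
    rw [← h.2]
    module
  exact (smul_eq_zero.1 h2d).resolve_left two_ne_zero

/-- The variation of parameters formula for systems with reflection:
with `X`, `Y` fundamental-type solutions of the two associated homogeneous problems,
`𝒳` invertible on the symmetric interval `J = (−r, r)` (`r ∈ (0,∞]`), and
`(w₁, w₂) = 𝒳⁻¹·((F−G)⁻¹γ_o, (F+G)⁻¹γ_e)`, the function
`u(t) = X(t)c + X(t)∫₀ᵗ w₁ + Y(t)∫₀ᵗ w₂` solves the nonhomogeneous problem on `J`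
for every `c`, and every solution `v` on `J` arises this way with `c = X(0)⁻¹v(0)`. -/
theorem stmt_17 (n : ℕ) (A B F G : Matrix (Fin n) (Fin n) ℝ)
    (h1 : IsUnit (F + G)) (h2 : IsUnit (F - G))
    (γ : ℝ → Fin n → ℝ) (hγ : Continuous γ)
    (X Y X' Y' : ℝ → Matrix (Fin n) (Fin n) ℝ)
    (hXd : ∀ (t : ℝ) (i j : Fin n), HasDerivAt (fun s => X s i j) (X' t i j) t)
    (hYd : ∀ (t : ℝ) (i j : Fin n), HasDerivAt (fun s => Y s i j) (Y' t i j) t)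
    (hXeq : ∀ t : ℝ, F * X' t + G * X' (-t) + A * X t + B * X (-t) = 0)
    (hYeq : ∀ t : ℝ, F * Y' t - G * Y' (-t) + A * Y t - B * Y (-t) = 0)
    (hX0 : IsUnit (X 0)) (hY0 : IsUnit (Y 0))
    (J : Set ℝ)
    (hJ : (∃ r : ℝ, 0 < r ∧ J = Set.Ioo (-r) r) ∨ J = Set.univ)
    (hinv : ∀ s ∈ J, IsUnit (scrX X Y s))
    (w₁ w₂ : ℝ → Fin n → ℝ)
    (hw : ∀ s ∈ J, Sum.elim (w₁ s) (w₂ s) = (scrX X Y s)⁻¹.mulVec (Sum.elim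
        ((F - G)⁻¹.mulVec ((2 : ℝ)⁻¹ • (γ s - γ (-s))))
        ((F + G)⁻¹.mulVec ((2 : ℝ)⁻¹ • (γ s + γ (-s)))))) :
    (∀ (c : Fin n → ℝ) (u : ℝ → Fin n → ℝ),
      (∀ t : ℝ, u t = (X t).mulVec c + (X t).mulVec (∫ s in (0:ℝ)..t, w₁ s)
          + (Y t).mulVec (∫ s in (0:ℝ)..t, w₂ s)) →
      ∀ t ∈ J, DifferentiableAt ℝ u t ∧
        F.mulVec (deriv u t) + G.mulVec (deriv u (-t))
          + A.mulVec (u t) + B.mulVec (u (-t)) = γ t) ∧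
    (∀ v : ℝ → Fin n → ℝ,
      (∀ t ∈ J, DifferentiableAt ℝ v t) →
      (∀ t ∈ J, F.mulVec (deriv v t) + G.mulVec (deriv v (-t))
        + A.mulVec (v t) + B.mulVec (v (-t)) = γ t) →
      ∀ u : ℝ → Fin n → ℝ,
        (∀ t : ℝ, u t = (X t).mulVec ((X 0)⁻¹.mulVec (v 0))
            + (X t).mulVec (∫ s in (0:ℝ)..t, w₁ s)
            + (Y t).mulVec (∫ s in (0:ℝ)..t, w₂ s)) →
        ∀ t ∈ J, v t = u t) := by
  obtain ⟨hJo, hJc, h0, hneg, hball⟩ : IsOpen J ∧ J.OrdConnected ∧ (0 : ℝ) ∈ J ∧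
      (∀ t ∈ J, -t ∈ J) ∧ ∀ t ∈ J, ∃ r : ℝ, 0 < r ∧ t ∈ Set.Ioo (-r) r ∧ Set.Ioo (-r) r ⊆ J := by
    rcases hJ with ⟨r, hr, rfl⟩ | rfl
    · exact ⟨isOpen_Ioo, Set.ordConnected_Ioo, ⟨neg_lt_zero.2 hr, hr⟩,
        fun t ht => ⟨neg_lt_neg ht.2, neg_lt.1 ht.1⟩, fun t ht => ⟨r, hr, ht, subset_rfl⟩⟩
    · exact ⟨isOpen_univ, Set.ordConnected_univ, trivial, fun _ _ => trivial,
        fun t _ => ⟨|t| + 1, by positivity, abs_lt.1 (lt_add_one _), Set.subset_univ _⟩⟩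
  set p : ℝ → Fin n → ℝ := fun s => (F - G)⁻¹.mulVec ((2 : ℝ)⁻¹ • (γ s - γ (-s))) with hp
  set q : ℝ → Fin n → ℝ := fun s => (F + G)⁻¹.mulVec ((2 : ℝ)⁻¹ • (γ s + γ (-s))) with hq
  have hsys : ∀ s ∈ J, (scrX X Y s).mulVec (Sum.elim (w₁ s) (w₂ s)) = Sum.elim (p s) (q s) := by
    intro s hs
    rw [hw s hs, Matrix.mulVec_mulVec,
      Matrix.mul_nonsing_inv _ ((Matrix.isUnit_iff_isUnit_det _).1 (hinv s hs)), Matrix.one_mulVec]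
  have hpar : ∀ s ∈ J, -w₁ (-s) = w₁ s ∧ w₂ (-s) = w₂ s := by
    intro s hs
    have hps : p (-s) = -p s := by
      simp only [hp, neg_neg]
      rw [← Matrix.mulVec_neg, ← smul_neg, neg_sub]
    have hqs : q (-s) = q s := by
      simp only [hq, neg_neg, add_comm]
    have h := hsys (-s) (hneg s hs)
    rw [hps, hqs] at h
    rw [← Sum.elim_eq_iff]
    exact Matrix.mulVec_injective_of_isUnit (hinv s hs)
      ((scrX_neg_mulVec_eq h).trans (hsys s hs).symm)
  have hwc : ContinuousOn (fun s => Sum.elim (w₁ s) (w₂ s)) J := by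
    refine ContinuousOn.congr (fun s hs => ContinuousAt.continuousWithinAt ?_) hw
    have hinvc := continuousAt_matrix_inv_comp (continuous_scrX
      (continuous_of_entries_hasDerivAt hXd) (continuous_of_entries_hasDerivAt hYd)) (hinv s hs)
    have hg : Continuous fun s => Sum.elim (p s) (q s) := by
      refine continuous_pi (Sum.rec (fun i => ?_) fun i => ?_)
      · exact (continuous_apply i).comp (by fun_prop : Continuous p)
      · exact (continuous_apply i).comp (by fun_prop : Continuous q)
    exact (continuous_fst.matrix_mulVec continuous_snd).continuousAt.comp
      (hinvc.prodMk hg.continuousAt)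
  have hw₁ : ContinuousOn w₁ J :=
    continuousOn_pi.2 fun i => continuousOn_pi.1 hwc (Sum.inl i)
  have hw₂ : ContinuousOn w₂ J :=
    continuousOn_pi.2 fun i => continuousOn_pi.1 hwc (Sum.inr i)
  set W₁ : ℝ → Fin n → ℝ := fun t => ∫ s in (0 : ℝ)..t, w₁ s with hW₁
  set W₂ : ℝ → Fin n → ℝ := fun t => ∫ s in (0 : ℝ)..t, w₂ s with hW₂
  have hW₁n : ∀ t ∈ J, W₁ (-t) = W₁ t := by
    intro t ht
    have h := integral_neg_of_eqOn hJc h0 (w := w₁) (z := fun s => -w₁ s)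
      (fun s hs => neg_eq_iff_eq_neg.1 (hpar s hs).1) ht
    rwa [intervalIntegral.integral_neg, neg_neg] at h
  have hW₂n : ∀ t ∈ J, W₂ (-t) = -W₂ t := fun t ht =>
    integral_neg_of_eqOn hJc h0 (fun s hs => (hpar s hs).2) ht
  have hsol : ∀ (c : Fin n → ℝ) (u : ℝ → Fin n → ℝ),
      (∀ t : ℝ, u t = (X t).mulVec c + (X t).mulVec (W₁ t) + (Y t).mulVec (W₂ t)) →
      ∀ t ∈ J, DifferentiableAt ℝ u t ∧
        F.mulVec (deriv u t) + G.mulVec (deriv u (-t))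
          + A.mulVec (u t) + B.mulVec (u (-t)) = γ t := by
    intro c u hu
    have hder : ∀ t ∈ J, HasDerivAt u ((X' t).mulVec (c + W₁ t) + (Y' t).mulVec (W₂ t)
        + ((X t).mulVec (w₁ t) + (Y t).mulVec (w₂ t))) t := by
      intro t ht
      have hX := hasDerivAt_mulVec (hXd t)
        ((hasDerivAt_integral_of_continuousOn hJo hJc h0 hw₁ ht).const_add c)
      have hY := hasDerivAt_mulVec (hYd t)
        (hasDerivAt_integral_of_continuousOn hJo hJc h0 hw₂ ht)
      refine ((hX.add hY).congr_deriv ?_).congr_of_eventuallyEq (.of_forall fun s => ?_)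
      · abel
      · simp only [hu s, Pi.add_apply, Matrix.mulVec_add, hW₁, hW₂]
    intro t ht
    refine ⟨(hder t ht).differentiableAt, ?_⟩
    obtain ⟨hsum, hdiff⟩ := mulVec_eq_of_scrX_mulVec_eq (hsys t ht)
    rw [(hder t ht).deriv, (hder (-t) (hneg t ht)).deriv, hu t, hu (-t), hW₁n t ht, hW₂n t ht,
      neg_eq_iff_eq_neg.1 (hpar t ht).1, (hpar t ht).2, hsum, Matrix.mulVec_neg (w₁ t) (X (-t)),
      hdiff]
    have hpt : (F - G).mulVec (p t) = (2 : ℝ)⁻¹ • (γ t - γ (-t)) := by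
      rw [hp, Matrix.mulVec_mulVec,
        Matrix.mul_nonsing_inv _ ((Matrix.isUnit_iff_isUnit_det _).1 h2), Matrix.one_mulVec]
    have hqt : (F + G).mulVec (q t) = (2 : ℝ)⁻¹ • (γ t + γ (-t)) := by
      rw [hq, Matrix.mulVec_mulVec,
        Matrix.mul_nonsing_inv _ ((Matrix.isUnit_iff_isUnit_det _).1 h1), Matrix.one_mulVec]
    have hγt : γ t = (F - G).mulVec (p t) + (F + G).mulVec (q t) := by
      rw [hpt, hqt]
      module
    have hXY : (F * X' t + G * X' (-t) + A * X t + B * X (-t)).mulVec (c + W₁ t)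
        + (F * Y' t - G * Y' (-t) + A * Y t - B * Y (-t)).mulVec (W₂ t) = 0 := by
      rw [hXeq, hYeq, Matrix.zero_mulVec, Matrix.zero_mulVec, add_zero]
    rw [hγt]
    refine sub_eq_zero.1 (Eq.trans ?_ hXY)
    simp only [Matrix.add_mulVec, Matrix.sub_mulVec, Matrix.mulVec_add, Matrix.mulVec_sub,
      Matrix.mulVec_neg, ← Matrix.mulVec_mulVec]
    abel
  refine ⟨hsol, fun v hv hveq u hu t ht => ?_⟩
  have hu' := hsol _ u hu
  obtain ⟨r, hr, htr, hrJ⟩ := hball t ht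
  refine sub_eq_zero.1 (eq_zero_of_reflection_ode (A := A) (B := B) h1 h2 hr (d := v - u)
    (d' := fun s => deriv v s - deriv u s)
    (fun s hs => (hv s (hrJ hs)).hasDerivAt.sub (hu' s (hrJ hs)).1.hasDerivAt)
    (fun s hs => ?_) ?_ t htr)
  · rw [← sub_eq_zero.2 ((hveq s (hrJ hs)).trans (hu' s (hrJ hs)).2.symm)]
    simp only [Pi.sub_apply, Matrix.mulVec_sub]
    abel
  · simp [hu 0, Matrix.mulVec_mulVec,
      Matrix.mul_nonsing_inv _ ((Matrix.isUnit_iff_isUnit_det _).1 hX0)]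
end
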